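/- Let T be a densely defined symmetric operator on a complex Hilbert space that is positive (⟨Tx, x⟩ ≥ 0 on its domain), and suppose T admits a positive selfadjoint extension B. If additionally T^ℓ (for some positive integer ℓ) is essentially selfadjoint with closure A, then B^ℓ = A, and consequently B = A^{1/ℓ}; in particular the positive selfadjoint extension of T with this property is unique. -/

import Mathlib

open scoped InnerProductSpace

variable {H : Type*} [NormedAddCommGroup H] [InnerProductSpace ℂ H] [CompleteSpace H]

/-- `powGraphRel B ℓ x y` says that `(x, y)` belongs to the graph of the `ℓ`-fold
composition `B^ℓ = B ∘ ⋯ ∘ B` of the (possibly unbounded) operator `B`. -/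
def powGraphRel (B : H →ₗ.[ℂ] H) (ℓ : ℕ) (x y : H) : Prop :=
  ∃ z : Fin (ℓ + 1) → H, z 0 = x ∧ z (Fin.last ℓ) = y ∧
    ∀ i : Fin ℓ, (z i.castSucc, z i.succ) ∈ B.graph

section InnerProductSpace

variable {E : Type*} [NormedAddCommGroup E] [InnerProductSpace ℂ E]

/-! ### Powers of a linear partial map as graphs -/

theorem powGraphRel_zero_iff {B : E →ₗ.[ℂ] E} {x y : E} : powGraphRel B 0 x y ↔ y = x := by
  constructor
  · rintro ⟨z, rfl, rfl, -⟩
    rfl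
  · rintro rfl
    exact ⟨fun _ => y, rfl, rfl, fun i => i.elim0⟩

theorem powGraphRel_succ_iff {B : E →ₗ.[ℂ] E} {n : ℕ} {x y : E} :
    powGraphRel B (n + 1) x y ↔ ∃ w, powGraphRel B n x w ∧ (w, y) ∈ B.graph := by
  constructor
  · rintro ⟨z, rfl, rfl, hz⟩
    exact ⟨z (Fin.last n).castSucc, ⟨fun i => z i.castSucc, rfl, rfl, fun i => hz i.castSucc⟩,
      hz (Fin.last n)⟩
  · rintro ⟨w, ⟨z, rfl, rfl, hz⟩, hwy⟩
    refine ⟨Fin.snoc (α := fun _ => E) z y, ?_, by simp, fun i => ?_⟩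
    · exact Fin.snoc_castSucc (α := fun _ => E) y z 0
    · induction i using Fin.lastCases with
      | last => simpa using hwy
      | cast i => simpa [Fin.succ_castSucc, -Fin.castSucc_succ] using hz i

theorem powGraphRel.mono {B C : E →ₗ.[ℂ] E} (hBC : B ≤ C) {n : ℕ} {x y : E}
    (h : powGraphRel B n x y) : powGraphRel C n x y := by
  obtain ⟨z, h0, h1, hz⟩ := h
  exact ⟨z, h0, h1, fun i => LinearPMap.le_graph_of_le hBC (hz i)⟩

theorem powGraphRel_iff_exists_of_resolvent {B : E →ₗ.[ℂ] E} {R : E →L[ℂ] E}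
    (hinj : Function.Injective R) (hR : ∀ x y : E, (x, y) ∈ B.graph ↔ R (x + y) = x)
    (n : ℕ) (x y : E) :
    powGraphRel B n x y ↔ ∃ v, (R ^ n) v = x ∧ ((1 - R) ^ n) v = y := by
  have hcomm (k : ℕ) : Commute R ((1 - R) ^ k) :=
    ((Commute.one_right R).sub_right (Commute.refl R)).pow_right k
  induction n generalizing y with
  | zero =>
    rw [powGraphRel_zero_iff]
    simp only [pow_zero, one_apply_eq_self]
    exact ⟨fun h => ⟨x, rfl, h.symm⟩, fun ⟨v, h, h'⟩ => h'.symm.trans h⟩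
  | succ k ih =>
    rw [powGraphRel_succ_iff]
    simp only [ih]
    constructor
    · rintro ⟨w, ⟨v, rfl, rfl⟩, hwy⟩
      rw [hR] at hwy
      set s := ((1 - R) ^ k) v + y with hs
      obtain ⟨P, hP⟩ : R ∣ 1 - (1 - R) ^ k := by
        simpa using (Commute.one_left (1 - R)).sub_dvd_pow_sub_pow k
      have hv : R (s + P v) = v := by
        have h := congrArg (fun L : E →L[ℂ] E => L v) hP
        simp only [sub_apply, one_apply_eq_self,
          mul_apply_eq_comp] at h
        rw [map_add, hwy, ← h]
        abel
      have hu : ((1 - R) ^ k) (s + P v) = s := by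
        apply hinj
        rw [← mul_apply_eq_comp, (hcomm k).eq, mul_apply_eq_comp, hv, hwy]
      refine ⟨s + P v, ?_, ?_⟩
      · rw [pow_succ, mul_apply_eq_comp, hv]
      · rw [pow_succ', mul_apply_eq_comp, hu, sub_apply, hwy, hs,
          one_apply_eq_self, add_sub_cancel_left]
    · rintro ⟨v, rfl, rfl⟩
      refine ⟨((1 - R) ^ k) (R v), ⟨R v, ?_, rfl⟩, ?_⟩
      · rw [pow_succ, mul_apply_eq_comp]
      · rw [hR, pow_succ', mul_apply_eq_comp, ← mul_apply_eq_comp _ R,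
          ← (hcomm k).eq, mul_apply_eq_comp]
        simp

theorem LinearPMap.re_inner_nonneg_of_mem_graph {B : E →ₗ.[ℂ] E}
    (hBpos : ∀ x : B.domain, 0 ≤ (⟪B x, (x : E)⟫_ℂ).re) {x y : E} (h : (x, y) ∈ B.graph) :
    0 ≤ (⟪y, x⟫_ℂ).re := by
  obtain ⟨u, hu, hu'⟩ := (LinearPMap.mem_graph_iff B).mp h
  simp only at hu hu'
  rw [← hu, ← hu']
  exact hBpos u

theorem norm_sq_add_norm_sq_le_of_re_inner_nonneg {x y : E} (h : 0 ≤ (⟪y, x⟫_ℂ).re) :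
    ‖x‖ ^ 2 + ‖y‖ ^ 2 ≤ ‖x + y‖ ^ 2 := by
  have := norm_add_sq (𝕜 := ℂ) y x
  rw [add_comm y x] at this
  simp only [RCLike.re_to_complex] at this
  linarith

end InnerProductSpace

/-! ### The resolvent of a positive selfadjoint operator -/

theorem IsSelfAdjoint.mem_graph_iff_forall_inner {B : H →ₗ.[ℂ] H} (hB : IsSelfAdjoint B)
    {x y : H} :
    (x, y) ∈ B.graph ↔ ∀ a b : H, (a, b) ∈ B.graph → ⟪b, x⟫_ℂ = ⟪a, y⟫_ℂ := by
  have h := LinearPMap.adjoint_graph_eq_graph_adjoint hB.dense_domain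
  rw [LinearPMap.isSelfAdjoint_def.mp hB] at h
  conv_lhs => rw [h, Submodule.mem_adjoint_iff]
  simp only [sub_eq_zero]

/-- The resolvent `R = (1 + B)⁻¹` of a positive selfadjoint operator `B`. -/
theorem IsSelfAdjoint.exists_resolvent {B : H →ₗ.[ℂ] H} (hB : IsSelfAdjoint B)
    (hBpos : ∀ x : B.domain, 0 ≤ (⟪B x, (x : H)⟫_ℂ).re) :
    ∃ R : H →L[ℂ] H, 0 ≤ R ∧ R ≤ 1 ∧ Function.Injective R ∧
      ∀ x y : H, (x, y) ∈ B.graph ↔ R (x + y) = x := by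
  have hclosed : IsClosed (B.graph : Set (H × H)) := hB.isClosed
  have : CompleteSpace B.graph := hclosed.completeSpace_coe
  let φ : B.graph →L[ℂ] H :=
    (ContinuousLinearMap.fst ℂ H H + ContinuousLinearMap.snd ℂ H H) ∘L B.graph.subtypeL
  have hφ (p : B.graph) : φ p = p.1.1 + p.1.2 := rfl
  have hnorm (p : B.graph) : ‖p‖ ≤ ‖φ p‖ := by
    have h := norm_sq_add_norm_sq_le_of_re_inner_nonneg
      (LinearPMap.re_inner_nonneg_of_mem_graph hBpos p.2)
    rw [hφ, Submodule.coe_norm, Prod.norm_def]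
    exact max_le (abs_le_of_sq_le_sq' (by nlinarith [sq_nonneg ‖p.1.2‖]) (norm_nonneg _)).2
      (abs_le_of_sq_le_sq' (by nlinarith [sq_nonneg ‖p.1.1‖]) (norm_nonneg _)).2
  have hanti : AntilipschitzWith 1 φ :=
    φ.antilipschitz_of_bound (by simpa using hnorm)
  have hrange_closed : IsClosed (φ.range : Set H) :=
    hanti.isClosed_range φ.uniformContinuous
  have hsurj : φ.range = ⊤ := by
    have : CompleteSpace φ.range := hrange_closed.completeSpace_coe
    rw [← Submodule.orthogonal_eq_bot_iff, eq_bot_iff]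
    intro z hz
    rw [Submodule.mem_orthogonal] at hz
    have hmem : (z, -z) ∈ B.graph := hB.mem_graph_iff_forall_inner.mpr fun a b hab => by
      have h := hz (a + b) ⟨⟨(a, b), hab⟩, rfl⟩
      rw [inner_add_left] at h
      rw [inner_neg_right]
      linear_combination h
    have h := LinearPMap.re_inner_nonneg_of_mem_graph hBpos hmem
    rw [inner_neg_left, Complex.neg_re, ← RCLike.re_to_complex, inner_self_eq_norm_sq] at h
    simpa using (by nlinarith [norm_nonneg z] : ‖z‖ = 0)
  let e := ContinuousLinearEquiv.ofBijective φ (LinearMap.ker_eq_bot.mpr hanti.injective) hsurj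
  have he (p : B.graph) : e p = p.1.1 + p.1.2 := rfl
  let R : H →L[ℂ] H :=
    ContinuousLinearMap.fst ℂ H H ∘L B.graph.subtypeL ∘L (e.symm : H →L[ℂ] B.graph)
  have hR (v : H) : R v = (e.symm v).1.1 := rfl
  have hgraph (v : H) : (R v, v - R v) ∈ B.graph := by
    have h := (he (e.symm v)).symm
    rw [e.apply_symm_apply] at h
    have h' : v - R v = (e.symm v).1.2 := by
      rw [hR, sub_eq_iff_eq_add']
      exact h.symm
    rw [h']
    exact (e.symm v).2
  have hiff (x y : H) : (x, y) ∈ B.graph ↔ R (x + y) = x := by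
    constructor
    · intro h
      have h' : x + y = e ⟨(x, y), h⟩ := (he ⟨(x, y), h⟩).symm
      rw [h', hR, e.symm_apply_apply]
    · intro h
      have h' := hgraph (x + y)
      rwa [h, add_sub_cancel_left] at h'
  have hsymm : (R : H →ₗ[ℂ] H).IsSymmetric := fun u v => by
    have h := hB.mem_graph_iff_forall_inner.mp (hgraph v) _ _ (hgraph u)
    rw [inner_sub_left, inner_sub_right] at h
    simp only [ContinuousLinearMap.coe_coe]
    linear_combination -h
  have hre (v : H) : 0 ≤ (⟪v - R v, R v⟫_ℂ).re :=
    LinearPMap.re_inner_nonneg_of_mem_graph hBpos (hgraph v)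
  refine ⟨R, ?_, ?_, ?_, hiff⟩
  · rw [ContinuousLinearMap.nonneg_iff_isPositive]
    refine ⟨hsymm, fun v => ?_⟩
    have h := hre v
    have h' : 0 ≤ (⟪R v, R v⟫_ℂ).re := inner_self_nonneg (𝕜 := ℂ)
    rw [inner_sub_left, Complex.sub_re] at h
    rw [ContinuousLinearMap.reApplyInnerSelf_apply, inner_re_symm, RCLike.re_to_complex]
    linarith
  · rw [ContinuousLinearMap.le_def]
    refine ⟨LinearMap.IsSymmetric.id.sub hsymm, fun v => ?_⟩
    have h := hre v
    have h' : 0 ≤ (⟪v - R v, v - R v⟫_ℂ).re := inner_self_nonneg (𝕜 := ℂ)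
    rw [inner_sub_right, Complex.sub_re] at h'
    rw [ContinuousLinearMap.reApplyInnerSelf_apply, RCLike.re_to_complex]
    simp only [sub_apply, one_apply_eq_self]
    linarith
  · rw [injective_iff_map_eq_zero]
    intro v hv
    have h := hgraph v
    rw [hv, sub_zero] at h
    exact LinearPMap.graph_fst_eq_zero_snd _ h rfl

/-! ### Functional calculus for the resolvent of a power -/

/-- If `t = (1 + b)⁻¹`, then `resolventPow n t = (1 + b ^ n)⁻¹`. -/
noncomputable def resolventPow (n : ℕ) (t : ℝ) : ℝ := t ^ n * (t ^ n + (1 - t) ^ n)⁻¹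

/-- The inverse of `resolventPow n` on the unit interval. -/
noncomputable def resolventRoot (n : ℕ) (s : ℝ) : ℝ :=
  s ^ (n⁻¹ : ℝ) / (s ^ (n⁻¹ : ℝ) + (1 - s) ^ (n⁻¹ : ℝ))

theorem pow_add_one_sub_pow_pos (n : ℕ) {t : ℝ} (ht : t ∈ Set.Icc (0 : ℝ) 1) :
    0 < t ^ n + (1 - t) ^ n := by
  obtain ⟨h0, h1⟩ := ht
  rcases h0.eq_or_lt with rfl | h
  · simp only [sub_zero, one_pow]
    positivity
  · have : 0 ≤ 1 - t := sub_nonneg.mpr h1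
    positivity

theorem rpow_add_one_sub_rpow_pos (p : ℝ) {t : ℝ} (ht : t ∈ Set.Icc (0 : ℝ) 1) :
    0 < t ^ p + (1 - t) ^ p := by
  obtain ⟨h0, h1⟩ := ht
  have h1' : 0 ≤ 1 - t := sub_nonneg.mpr h1
  rcases h0.eq_or_lt with rfl | h
  · simp only [sub_zero, Real.one_rpow]
    positivity
  · positivity

theorem continuousOn_inv_pow_add_one_sub_pow (n : ℕ) :
    ContinuousOn (fun t : ℝ => (t ^ n + (1 - t) ^ n)⁻¹) (Set.Icc 0 1) :=
  ContinuousOn.inv₀ (by fun_prop) fun _ ht => (pow_add_one_sub_pow_pos n ht).ne'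

theorem continuousOn_resolventPow (n : ℕ) : ContinuousOn (resolventPow n) (Set.Icc 0 1) :=
  ContinuousOn.mul (by fun_prop) (continuousOn_inv_pow_add_one_sub_pow n)

theorem continuousOn_resolventRoot (n : ℕ) : ContinuousOn (resolventRoot n) (Set.Icc 0 1) := by
  have hp : (0 : ℝ) ≤ (n⁻¹ : ℝ) := by positivity
  have h1 : Continuous fun s : ℝ => s ^ (n⁻¹ : ℝ) := Real.continuous_rpow_const hp
  have h2 : Continuous fun s : ℝ => (1 - s) ^ (n⁻¹ : ℝ) := h1.comp (by fun_prop)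
  exact h1.continuousOn.div (h1.add h2).continuousOn
    fun _ ht => (rpow_add_one_sub_rpow_pos _ ht).ne'

theorem one_sub_resolventPow (n : ℕ) {t : ℝ} (ht : t ∈ Set.Icc (0 : ℝ) 1) :
    1 - resolventPow n t = (1 - t) ^ n * (t ^ n + (1 - t) ^ n)⁻¹ := by
  have := (pow_add_one_sub_pow_pos n ht).ne'
  rw [resolventPow]
  field_simp
  ring

theorem resolventPow_mem_Icc (n : ℕ) {t : ℝ} (ht : t ∈ Set.Icc (0 : ℝ) 1) :
    resolventPow n t ∈ Set.Icc (0 : ℝ) 1 := by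
  have hpos := pow_add_one_sub_pow_pos n ht
  have h1 : 0 ≤ 1 - t := sub_nonneg.mpr ht.2
  have h0 : 0 ≤ t := ht.1
  constructor
  · rw [resolventPow]
    positivity
  · rw [← sub_nonneg, one_sub_resolventPow n ht]
    positivity

theorem resolventRoot_resolventPow {n : ℕ} (hn : n ≠ 0) {t : ℝ} (ht : t ∈ Set.Icc (0 : ℝ) 1) :
    resolventRoot n (resolventPow n t) = t := by
  have hpos := pow_add_one_sub_pow_pos n ht
  have h1 : 0 ≤ 1 - t := sub_nonneg.mpr ht.2
  have h0 : 0 ≤ t := ht.1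
  have hc := (Real.rpow_pos_of_pos (inv_pos.mpr hpos) (n⁻¹ : ℝ)).ne'
  rw [resolventRoot, one_sub_resolventPow n ht, resolventPow,
    Real.mul_rpow (by positivity) (by positivity), Real.mul_rpow (by positivity) (by positivity),
    Real.pow_rpow_inv_natCast h0 hn, Real.pow_rpow_inv_natCast h1 hn, ← add_mul,
    add_sub_cancel, one_mul, mul_div_cancel_right₀ _ hc]

section Bounded

variable {R : H →L[ℂ] H}

theorem spectrum_subset_Icc_zero_one (h0 : 0 ≤ R) (h1 : R ≤ 1) :
    spectrum ℝ R ⊆ Set.Icc 0 1 := fun t ht =>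
  ⟨spectrum_nonneg_of_nonneg h0 ht, (CFC.le_one_iff R).mp h1 t ht⟩

theorem cfc_resolventRoot_cfc_resolventPow (h0 : 0 ≤ R) (h1 : R ≤ 1) {n : ℕ} (hn : n ≠ 0) :
    cfc (resolventRoot n) (cfc (resolventPow n) R) = R := by
  have hsa : IsSelfAdjoint R := .of_nonneg h0
  have hspec := spectrum_subset_Icc_zero_one h0 h1
  rw [← cfc_comp (resolventRoot n) (resolventPow n) R hsa
    ((continuousOn_resolventRoot n).mono
      (Set.image_subset_iff.mpr fun t ht => resolventPow_mem_Icc n (hspec ht)))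
    ((continuousOn_resolventPow n).mono hspec)]
  conv_rhs => rw [← cfc_id' ℝ R]
  exact cfc_congr fun t ht => resolventRoot_resolventPow hn (hspec ht)

theorem exists_pow_apply_iff_cfc_resolventPow (h0 : 0 ≤ R) (h1 : R ≤ 1) (n : ℕ) (x y : H) :
    (∃ v, (R ^ n) v = x ∧ ((1 - R) ^ n) v = y) ↔ cfc (resolventPow n) R (x + y) = x := by
  have hsa : IsSelfAdjoint R := .of_nonneg h0
  have hspec := spectrum_subset_Icc_zero_one h0 h1
  have hcont := (continuousOn_inv_pow_add_one_sub_pow n).mono hspec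
  have hcontD : ContinuousOn (fun t : ℝ => t ^ n + (1 - t) ^ n) (spectrum ℝ R) := by fun_prop
  set E := cfc (fun t : ℝ => (t ^ n + (1 - t) ^ n)⁻¹) R with hE
  have hD : cfc (fun t : ℝ => t ^ n + (1 - t) ^ n) R = R ^ n + (1 - R) ^ n := by
    rw [cfc_add .., cfc_pow .., cfc_pow .., cfc_sub .., cfc_id' ℝ R, cfc_const_one ℝ R]
  have hED : E * (R ^ n + (1 - R) ^ n) = 1 := by
    rw [← hD, hE, ← cfc_mul _ _ R hcont hcontD, ← cfc_const_one ℝ R]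
    exact cfc_congr fun t ht => inv_mul_cancel₀ (pow_add_one_sub_pow_pos n (hspec ht)).ne'
  have hDE : (R ^ n + (1 - R) ^ n) * E = 1 := by
    rw [← hD, hE, ← cfc_mul _ _ R hcontD hcont, ← cfc_const_one ℝ R]
    exact cfc_congr fun t ht => mul_inv_cancel₀ (pow_add_one_sub_pow_pos n (hspec ht)).ne'
  have hQ : cfc (resolventPow n) R = R ^ n * E := by
    rw [← cfc_pow_id (R := ℝ) R n, hE, ← cfc_mul _ _ R (by fun_prop) hcont]
    rfl
  rw [hQ, mul_apply_eq_comp]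
  constructor
  · rintro ⟨v, rfl, rfl⟩
    rw [← add_apply, ← mul_apply_eq_comp E, hED,
      one_apply_eq_self]
  · intro h
    refine ⟨E (x + y), h, ?_⟩
    have h' := congrArg (fun L : H →L[ℂ] H => L (x + y)) hDE
    simp only [mul_apply_eq_comp, add_apply,
      one_apply_eq_self, h] at h'
    exact add_left_cancel h'

end Bounded

/-- The graph of a power of a positive selfadjoint operator with resolvent `R` is described by
the bounded selfadjoint operator `cfc (resolventPow n) R`. -/
theorem IsSelfAdjoint.exists_resolvent_powGraphRel {B : H →ₗ.[ℂ] H} (hB : IsSelfAdjoint B)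
    (hBpos : ∀ x : B.domain, 0 ≤ (⟪B x, (x : H)⟫_ℂ).re) (n : ℕ) :
    ∃ R : H →L[ℂ] H, 0 ≤ R ∧ R ≤ 1 ∧ (∀ x y : H, (x, y) ∈ B.graph ↔ R (x + y) = x) ∧
      ∀ x y : H, powGraphRel B n x y ↔ cfc (resolventPow n) R (x + y) = x := by
  obtain ⟨R, h0, h1, hinj, hR⟩ := hB.exists_resolvent hBpos
  exact ⟨R, h0, h1, hR, fun x y => (powGraphRel_iff_exists_of_resolvent hinj hR n x y).trans
    (exists_pow_apply_iff_cfc_resolventPow h0 h1 n x y)⟩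

/-- A positive selfadjoint operator is determined by any of its positive powers. -/
theorem IsSelfAdjoint.eq_of_powGraphRel_iff {B C : H →ₗ.[ℂ] H} (hB : IsSelfAdjoint B)
    (hBpos : ∀ x : B.domain, 0 ≤ (⟪B x, (x : H)⟫_ℂ).re) (hC : IsSelfAdjoint C)
    (hCpos : ∀ x : C.domain, 0 ≤ (⟪C x, (x : H)⟫_ℂ).re) {n : ℕ} (hn : n ≠ 0)
    (h : ∀ x y : H, powGraphRel B n x y ↔ powGraphRel C n x y) : B = C := by
  obtain ⟨R, hR0, hR1, hR, hRn⟩ := hB.exists_resolvent_powGraphRel hBpos n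
  obtain ⟨R', hR'0, hR'1, hR', hR'n⟩ := hC.exists_resolvent_powGraphRel hCpos n
  have hQ : cfc (resolventPow n) R = cfc (resolventPow n) R' := by
    ext v
    have h' := (h (cfc (resolventPow n) R v) (v - cfc (resolventPow n) R v)).mp
      ((hRn _ _).mpr (by rw [add_sub_cancel]))
    rw [hR'n, add_sub_cancel] at h'
    exact h'.symm
  have hRR' : R = R' := by
    rw [← cfc_resolventRoot_cfc_resolventPow hR0 hR1 hn, hQ,
      cfc_resolventRoot_cfc_resolventPow hR'0 hR'1 hn]
  apply LinearPMap.eq_of_eq_graph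
  ext ⟨x, y⟩
  rw [hR, hR', hRR']

/-- If the power `T ^ n` of a restriction `T` of a positive selfadjoint operator `B` is essentially
selfadjoint, then its closure is `B ^ n`. -/
theorem IsSelfAdjoint.mem_graph_closure_iff_powGraphRel {T B S : H →ₗ.[ℂ] H}
    (hB : IsSelfAdjoint B) (hBpos : ∀ x : B.domain, 0 ≤ (⟪B x, (x : H)⟫_ℂ).re) (hTB : T ≤ B)
    {n : ℕ} (hS : ∀ x y : H, (x, y) ∈ S.graph ↔ powGraphRel T n x y)
    (hess : IsSelfAdjoint S.closure) (x y : H) :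
    (x, y) ∈ S.closure.graph ↔ powGraphRel B n x y := by
  obtain ⟨R, -, -, -, hRn⟩ := hB.exists_resolvent_powGraphRel hBpos n
  set Q := cfc (resolventPow n) R
  have hQsymm : (Q : H →ₗ[ℂ] H).IsSymmetric := (cfc_predicate (resolventPow n) R :
    IsSelfAdjoint Q).isSymmetric
  have hclosable : S.IsClosable := hess.isClosed.isClosable.leIsClosable S.le_closure
  have hsub {a b : H} (hab : (a, b) ∈ S.closure.graph) : Q (a + b) = a := by
    have hcl : IsClosed {p : H × H | Q (p.1 + p.2) = p.1} :=
      isClosed_eq (by fun_prop) (by fun_prop)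
    rw [← hclosable.graph_closure_eq_closure_graph] at hab
    exact closure_minimal (fun p hp => (hRn p.1 p.2).mp (((hS _ _).mp hp).mono hTB)) hcl hab
  rw [hRn]
  refine ⟨hsub, fun h => hess.mem_graph_iff_forall_inner.mpr fun a b hab => ?_⟩
  have hsymm := hQsymm (a + b) (x + y)
  simp only [ContinuousLinearMap.coe_coe, hsub hab, h, inner_add_left, inner_add_right] at hsymm
  linear_combination -hsymm

/-- Let `T` be a densely defined, symmetric, positive operator on a complex
Hilbert space admitting a positive selfadjoint extension `B`.  Suppose that for some
positive integer `ℓ` the power `T^ℓ` (here: the operator `S` whose graph is that of the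
`ℓ`-fold composition of `T`) is essentially selfadjoint, with closure `A`.  Then
`B^ℓ = A` (equality of graphs), and consequently `B = A^{1/ℓ}`: `B` is the unique positive
selfadjoint `ℓ`-th root of `A`, and, in particular, the positive selfadjoint extension of
`T` with this property is unique. -/
theorem positive_selfAdjoint_extension_pow_eq_closure_and_unique
    (T B S A : H →ₗ.[ℂ] H)
    (hTdense : Dense (T.domain : Set H))
    (hTsymm : ∀ x y : T.domain, ⟪T x, (y : H)⟫_ℂ = ⟪(x : H), T y⟫_ℂ)
    (hTpos : ∀ x : T.domain, 0 ≤ (⟪T x, (x : H)⟫_ℂ).re)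
    (hBsa : IsSelfAdjoint B)
    (hBpos : ∀ x : B.domain, 0 ≤ (⟪B x, (x : H)⟫_ℂ).re)
    (hTB : T ≤ B)
    (ℓ : ℕ) (hℓ : 0 < ℓ)
    (hS : ∀ x y : H, (x, y) ∈ S.graph ↔ powGraphRel T ℓ x y)
    (hess : IsSelfAdjoint S.closure)
    (hA : A = S.closure) :
    (∀ x y : H, (x, y) ∈ A.graph ↔ powGraphRel B ℓ x y) ∧
    (∀ C : H →ₗ.[ℂ] H, IsSelfAdjoint C → (∀ x : C.domain, 0 ≤ (⟪C x, (x : H)⟫_ℂ).re) →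
      (∀ x y : H, (x, y) ∈ A.graph ↔ powGraphRel C ℓ x y) → C = B) ∧
    (∀ B' : H →ₗ.[ℂ] H, IsSelfAdjoint B' →
      (∀ x : B'.domain, 0 ≤ (⟪B' x, (x : H)⟫_ℂ).re) → T ≤ B' → B' = B) := by
  subst hA
  have hpow := hBsa.mem_graph_closure_iff_powGraphRel hBpos hTB hS hess
  refine ⟨hpow, fun C hC hCpos hCA => ?_, fun B' hB' hB'pos hTB' => ?_⟩
  · exact hC.eq_of_powGraphRel_iff hCpos hBsa hBpos hℓ.ne'
      fun x y => (hCA x y).symm.trans (hpow x y)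
  · exact hB'.eq_of_powGraphRel_iff hB'pos hBsa hBpos hℓ.ne' fun x y =>
      (hB'.mem_graph_closure_iff_powGraphRel hB'pos hTB' hS hess x y).symm.trans (hpow x y)
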